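/- Let H > 0, let R > π/H, let E be a real normed vector space, and let x : ℝ → E be differentiable with ‖x'(t)‖ ≤ 1 / cosh(H t) for all t. Write η(t) = (π/2 + arctan(sinh(H t))) / H. If ‖x(t₀)‖ < R − η(t₀) for some t₀, then ‖x(t)‖ < R for all t ≤ t₀. In particular, no causal curve of the Big Bounce metric reaching the region U' = {(t,x) : ‖x‖ < R − η(t)} can have started at the cylinder boundary {‖x‖ = R}. -/

import Mathlib

open Real

/-- The conformal time has derivative `1 / cosh (H t)`. -/
theorem hasDerivAt_conformalTime {H : ℝ} (hH : H ≠ 0) (t : ℝ) :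
    HasDerivAt (fun s => (π / 2 + Real.arctan (Real.sinh (H * s))) / H)
      (Real.cosh (H * t))⁻¹ t := by
  refine (((((hasDerivAt_id' t).const_mul H).sinh.arctan).const_add (π / 2)).div_const H).congr_deriv ?_
  have hc : Real.cosh (H * t) ≠ 0 := (Real.cosh_pos _).ne'
  have hs : 1 + Real.sinh (H * t) ^ 2 = Real.cosh (H * t) ^ 2 := by
    rw [Real.cosh_sq]; ring
  rw [hs]
  field_simp

/-- If `‖x'‖ ≤ B'` then the displacement of `x` is at most the increment of `B`. -/
theorem norm_sub_le_sub_of_norm_deriv_le {E : Type*} [NormedAddCommGroup E] [NormedSpace ℝ E]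
    {x : ℝ → E} (hx : Differentiable ℝ x) {B B' : ℝ → ℝ} (hB : ∀ t, HasDerivAt B (B' t) t)
    (bound : ∀ t, ‖deriv x t‖ ≤ B' t) {a b : ℝ} (hab : a ≤ b) :
    ‖x b - x a‖ ≤ B b - B a :=
  image_norm_le_of_norm_deriv_right_le_deriv_boundary
    (f := fun s => x s - x a) (B := fun s => B s - B a)
    (hx.continuous.sub continuous_const).continuousOn
    (fun s _ => ((hx s).hasDerivAt.sub_const (x a)).hasDerivWithinAt)
    (by simp) (fun s => (hB s).sub_const (B a)) (fun s _ => bound s)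
    (Set.right_mem_Icc.mpr hab)

/-- In the Big Bounce spacetime with `R > π/H`, a causal curve
`t ↦ (t, x(t))` (i.e. `‖x'(t)‖ ≤ 1/cosh(H t)`) that reaches the region
`U' = {(t,x) : ‖x‖ < R − η(t)}` was never at the cylinder boundary `{‖x‖ = R}`:
`‖x(t)‖ < R` for all `t ≤ t₀`. -/
theorem causal_curve_to_U'_missed_boundary
    (H : ℝ) (hH : 0 < H) (R : ℝ) (hR : π / H < R)
    {E : Type*} [NormedAddCommGroup E] [NormedSpace ℝ E]
    (x : ℝ → E) (hx : Differentiable ℝ x)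
    (hx' : ∀ t, ‖deriv x t‖ ≤ (Real.cosh (H * t))⁻¹)
    (η : ℝ → ℝ)
    (hη : ∀ t, η t = (π / 2 + Real.arctan (Real.sinh (H * t))) / H)
    (t₀ : ℝ) (h0 : ‖x t₀‖ < R - η t₀) :
    ∀ t, t ≤ t₀ → ‖x t‖ < R := by
  intro t ht
  have hη' : ∀ s, HasDerivAt η (Real.cosh (H * s))⁻¹ s := by
    rw [funext hη]
    exact hasDerivAt_conformalTime hH.ne'
  have hdist := norm_sub_le_sub_of_norm_deriv_le hx hη' hx' ht
  have hpos : 0 < η t := by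
    rw [hη]
    exact div_pos (by linarith [Real.neg_pi_div_two_lt_arctan (Real.sinh (H * t))]) hH
  have htri := norm_le_norm_add_norm_sub (x t₀) (x t)
  linarith
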